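/- Let n, m be positive integers, z ∈ ℝⁿ nonzero, T_z = {zw⊤ + wz⊤ : w ∈ ℝⁿ}, and P the orthogonal projection of symmetric n×n matrices onto T_z with respect to the Frobenius inner product. Let B be a linear map from symmetric n×n matrices to ℝ^m with adjoint B⊤, and suppose there are constants 0 < ϑ_lb ≤ ϑ_up with ϑ_lb‖W‖_F² ≤ (1/m)‖B(W)‖² ≤ ϑ_up‖W‖_F² for all W ∈ T_z. Then for every α > 0, the operator norm (with respect to the Frobenius norm) of the map W ↦ P(W) − (α/m)·P(B⊤(B(P(W)))) on symmetric matrices is at most max{|1 − αϑ_lb|, |1 − αϑ_up|}. -/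

import Mathlib

open Matrix

/-- Frobenius inner product. -/
def frobInner {n : ℕ} (A B : Matrix (Fin n) (Fin n) ℝ) : ℝ := ∑ i, ∑ j, A i j * B i j

/-- Frobenius norm. -/
noncomputable def frobNorm {n : ℕ} (A : Matrix (Fin n) (Fin n) ℝ) : ℝ :=
  Real.sqrt (∑ i, ∑ j, (A i j)^2)

/-- The tangent space `T_z = {z wᵀ + w zᵀ : w ∈ ℝⁿ}`. -/
def tangentSet {n : ℕ} (z : Fin n → ℝ) : Set (Matrix (Fin n) (Fin n) ℝ) :=
  {W | ∃ w : Fin n → ℝ, W = vecMulVec z w + vecMulVec w z}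

theorem fi_comm {n : ℕ} (A B : Matrix (Fin n) (Fin n) ℝ) : frobInner A B = frobInner B A := by
  simp [frobInner, mul_comm]

theorem fi_add {n : ℕ} (A B C : Matrix (Fin n) (Fin n) ℝ) :
    frobInner (A + B) C = frobInner A C + frobInner B C := by
  simp [frobInner, add_mul, Finset.sum_add_distrib]

theorem fi_sub {n : ℕ} (A B C : Matrix (Fin n) (Fin n) ℝ) :
    frobInner (A - B) C = frobInner A C - frobInner B C := by
  simp [frobInner, sub_mul, Finset.sum_sub_distrib]

theorem fi_smul {n : ℕ} (t : ℝ) (A C : Matrix (Fin n) (Fin n) ℝ) :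
    frobInner (t • A) C = t * frobInner A C := by
  simp [frobInner, Finset.mul_sum, mul_assoc]

theorem fi_nonneg {n : ℕ} (A : Matrix (Fin n) (Fin n) ℝ) : 0 ≤ frobInner A A :=
  Finset.sum_nonneg fun _ _ => Finset.sum_nonneg fun _ _ => mul_self_nonneg _

theorem fn_eq {n : ℕ} (A : Matrix (Fin n) (Fin n) ℝ) :
    frobNorm A = Real.sqrt (frobInner A A) := by
  simp [frobNorm, frobInner, sq]

theorem fn_sq {n : ℕ} (A : Matrix (Fin n) (Fin n) ℝ) :
    frobNorm A ^ 2 = frobInner A A := by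
  rw [fn_eq, Real.sq_sqrt (fi_nonneg A)]

theorem ts_symm {n : ℕ} {z : Fin n → ℝ} {U : Matrix (Fin n) (Fin n) ℝ}
    (hU : U ∈ tangentSet z) : U.IsSymm := by
  obtain ⟨w, rfl⟩ := hU
  ext i j
  simp [vecMulVec_apply]
  ring

theorem ts_comb {n : ℕ} {z : Fin n → ℝ} {U V : Matrix (Fin n) (Fin n) ℝ}
    (hU : U ∈ tangentSet z) (hV : V ∈ tangentSet z) (a b : ℝ) :
    a • U + b • V ∈ tangentSet z := by
  obtain ⟨w, rfl⟩ := hU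
  obtain ⟨v, rfl⟩ := hV
  refine ⟨a • w + b • v, ?_⟩
  ext i j
  simp [vecMulVec_apply]
  ring

/-- The operator norm (w.r.t. the Frobenius norm, on symmetric matrices) of
`W ↦ P(W) − (α/m)·P(Bᵀ(B(P(W))))` is at most `max{|1 − αϑ_lb|, |1 − αϑ_up|}`,
given the restricted well conditioned property of `B` on `T_z`. -/
theorem projected_operator_norm_bound
    (n m : ℕ) (hn : 0 < n) (hm : 0 < m)
    (z : Fin n → ℝ) (hz : z ≠ 0)
    (P : Matrix (Fin n) (Fin n) ℝ →ₗ[ℝ] Matrix (Fin n) (Fin n) ℝ)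
    (hPmem : ∀ W : Matrix (Fin n) (Fin n) ℝ, W.IsSymm → P W ∈ tangentSet z)
    (hPorth : ∀ W : Matrix (Fin n) (Fin n) ℝ, W.IsSymm →
      ∀ V ∈ tangentSet z, frobInner (W - P W) V = 0)
    (B : Matrix (Fin n) (Fin n) ℝ →ₗ[ℝ] (Fin m → ℝ))
    (Bt : (Fin m → ℝ) →ₗ[ℝ] Matrix (Fin n) (Fin n) ℝ)
    (hBtSymm : ∀ b : Fin m → ℝ, (Bt b).IsSymm)
    (hAdj : ∀ W : Matrix (Fin n) (Fin n) ℝ, W.IsSymm → ∀ b : Fin m → ℝ,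
      frobInner (Bt b) W = ∑ k, B W k * b k)
    (ϑlb ϑup : ℝ) (hϑlb : 0 < ϑlb) (hϑ : ϑlb ≤ ϑup)
    (hRWC : ∀ W ∈ tangentSet z,
      ϑlb * frobNorm W ^ 2 ≤ (1 / (m : ℝ)) * ∑ k, (B W k)^2 ∧
      (1 / (m : ℝ)) * ∑ k, (B W k)^2 ≤ ϑup * frobNorm W ^ 2)
    (α : ℝ) (hα : 0 < α) :
    ∀ W : Matrix (Fin n) (Fin n) ℝ, W.IsSymm →
      frobNorm (P W - (α / (m : ℝ)) • P (Bt (B (P W))))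
        ≤ max |1 - α * ϑlb| |1 - α * ϑup| * frobNorm W := by
  intro W hW
  obtain ⟨X, hX⟩ : ∃ X, X = P W := ⟨_, rfl⟩
  have hXT : X ∈ tangentSet z := hX ▸ hPmem W hW
  obtain ⟨M, hM⟩ : ∃ M, M = max |1 - α * ϑlb| |1 - α * ϑup| := ⟨_, rfl⟩
  have hM1 : |1 - α * ϑlb| ≤ M := hM ▸ le_max_left _ _
  have hM2 : |1 - α * ϑup| ≤ M := hM ▸ le_max_right _ _
  have hM0 : 0 ≤ M := (abs_nonneg _).trans hM1
  rw [← hX, ← hM]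
  have hZT := hPmem _ (hBtSymm (B X))
  have hZo := hPorth _ (hBtSymm (B X))
  obtain ⟨Z, hZ⟩ : ∃ Z, Z = P (Bt (B X)) := ⟨_, rfl⟩
  rw [← hZ] at hZT hZo ⊢
  obtain ⟨Y, hY⟩ : ∃ Y, Y = X - (α / (m : ℝ)) • Z := ⟨_, rfl⟩
  rw [← hY]
  have hYT : Y ∈ tangentSet z := by
    have h := ts_comb hXT hZT 1 (-(α / (m : ℝ)))
    rw [hY]
    convert h using 1
    module
  have hYY : frobInner Y Y = frobInner X Y - (α / m) * ∑ k, B X k * B Y k := by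
    have h1 := hZo Y hYT
    rw [fi_sub, hAdj Y (ts_symm hYT)] at h1
    have h2 : frobInner Y Y = frobInner X Y - (α / m) * frobInner Z Y := by
      conv_lhs => rw [hY, fi_sub, fi_smul, ← hY]
    have h3 : ∑ k, B X k * B Y k = ∑ k, B Y k * B X k :=
      Finset.sum_congr rfl fun k _ => mul_comm _ _
    rw [h2, h3]
    congr 2
    linarith
  have hq : ∀ U ∈ tangentSet z,
      |frobInner U U - (α / m) * ∑ k, (B U k) ^ 2| ≤ M * frobInner U U := by
    intro U hU
    obtain ⟨h1, h2⟩ := hRWC U hU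
    rw [fn_sq] at h1 h2
    have h0 := fi_nonneg U
    have e : (α / m) * ∑ k, (B U k) ^ 2 = α * ((1 / (m : ℝ)) * ∑ k, (B U k) ^ 2) := by ring
    rw [e]
    have g1 := mul_le_mul_of_nonneg_left h1 hα.le
    have g2 := mul_le_mul_of_nonneg_left h2 hα.le
    have k1 := mul_le_mul_of_nonneg_right ((le_abs_self _).trans hM1) h0
    have k2 := mul_le_mul_of_nonneg_right ((neg_le_abs _).trans hM2) h0
    rw [abs_le]
    constructor <;> nlinarith
  have hexpB : ∀ a b : ℝ, ∑ k, (B (a • X + b • Y) k) ^ 2 =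
      a ^ 2 * ∑ k, (B X k) ^ 2 + 2 * a * b * ∑ k, B X k * B Y k
        + b ^ 2 * ∑ k, (B Y k) ^ 2 := by
    intro a b
    simp only [Finset.mul_sum, ← Finset.sum_add_distrib]
    refine Finset.sum_congr rfl fun k _ => ?_
    simp
    ring
  have hexp : ∀ a b : ℝ, frobInner (a • X + b • Y) (a • X + b • Y) =
      a ^ 2 * frobInner X X + 2 * a * b * frobInner X Y + b ^ 2 * frobInner Y Y := by
    intro a b
    rw [fi_add, fi_smul, fi_smul, fi_comm X, fi_comm Y, fi_add, fi_add, fi_smul, fi_smul,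
      fi_smul, fi_smul, fi_comm Y X]
    ring
  have key : ∀ t : ℝ, 2 * t * frobInner Y Y ≤ M * (t ^ 2 * frobInner X X + frobInner Y Y) := by
    intro t
    have h1 := (abs_le.1 (hq _ (ts_comb hXT hYT t 1))).2
    have h2 := (abs_le.1 (hq _ (ts_comb hXT hYT t (-1)))).1
    rw [hexp, hexpB] at h1 h2
    have h3 : 2 * t * frobInner Y Y
        = 2 * t * (frobInner X Y - (α / m) * ∑ k, B X k * B Y k) := by rw [← hYY]
    rw [h3]
    linarith
  have hyx : frobInner Y Y ≤ M ^ 2 * frobInner X X := by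
    rcases hM0.eq_or_lt with h | h
    · have := key 1
      rw [← h] at this ⊢
      linarith
    · have := key M
      have h' : M * frobInner Y Y ≤ M * (M ^ 2 * frobInner X X) := by linarith
      exact le_of_mul_le_mul_left h' h
  have hxw : frobInner X X ≤ frobInner W W := by
    have h1 := hPorth W hW X hXT
    rw [← hX, fi_sub] at h1
    have h2 := fi_nonneg (W - X)
    rw [fi_sub, fi_comm W, fi_comm X, fi_sub, fi_sub, fi_comm X W] at h2
    linarith
  rw [fn_eq, fn_eq]
  apply Real.sqrt_le_iff.2
  refine ⟨by positivity, ?_⟩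
  rw [mul_pow, Real.sq_sqrt (fi_nonneg W)]
  exact hyx.trans (mul_le_mul_of_nonneg_left hxw (sq_nonneg M))
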